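/- arXiv:2506.16102 — 5 statements merged into one kernel-verified Lean document; each statement's English description precedes it below -/
import Mathlib

section
/- Let σ > 0 and let γ_σ be the Gaussian probability measure on ℝ with mean 0 and variance σ². If μ and ν are probability measures on ℝ with μ ≠ ν and KL(μ ‖ ν) < ∞, then KL(μ ∗ γ_σ ‖ ν ∗ γ_σ) < KL(μ ‖ ν). (Strict decrease of KL divergence under Gaussian smoothing of distinct distributions; this gives the strict inequality claimed in the paper's Theorem 1.) -/
open MeasureTheory ProbabilityTheory

/- Kullback–Leibler divergence: `∫ log (dμ/dν) dμ` if `μ ≪ ν` (and the log-likelihood ratio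
is integrable), and `+∞` otherwise. -/
open scoped Classical in
noncomputable def klDiv {α : Type*} [MeasurableSpace α] (μ ν : Measure α) : EReal :=
  if μ ≪ ν ∧ Integrable (llr μ ν) μ then ((∫ x, llr μ ν x ∂μ : ℝ) : EReal) else ⊤

open scoped ENNReal

theorem klDiv_eq_coe_klDiv {α : Type*} [MeasurableSpace α] (μ ν : Measure α)
    [IsProbabilityMeasure μ] [IsProbabilityMeasure ν] :
    klDiv μ ν = ((InformationTheory.klDiv μ ν : ℝ≥0∞) : EReal) := by
  by_cases h : μ ≪ ν ∧ Integrable (llr μ ν) μ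
  · have hne := InformationTheory.klDiv_ne_top h.1 h.2
    have hr := InformationTheory.toReal_klDiv_of_measure_eq h.1 (by simp)
    rw [klDiv, if_pos h, ← hr, EReal.coe_ennreal_toReal hne]
  · rw [klDiv, if_neg h, InformationTheory.klDiv_eq_top_iff.mpr (fun h1 h2 ↦ h ⟨h1, h2⟩)]
    rfl

/-- Data processing under addition of independent noise. -/
theorem klDiv_map_add_fst_le (μ ν γ : Measure ℝ)
    [IsProbabilityMeasure μ] [IsProbabilityMeasure ν] [IsProbabilityMeasure γ] :
    InformationTheory.klDiv ((μ.prod γ).map fun p : ℝ × ℝ ↦ (p.1 + p.2, p.1))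
      ((ν.prod γ).map fun p : ℝ × ℝ ↦ (p.1 + p.2, p.1)) ≤ InformationTheory.klDiv μ ν := by
  refine (InformationTheory.klDiv_map_le _ _ (by fun_prop)).trans_eq ?_
  rw [← Measure.compProd_const, ← Measure.compProd_const, InformationTheory.klDiv_compProd_left]

theorem fst_map_add_fst (μ γ : Measure ℝ) [IsProbabilityMeasure μ] [IsProbabilityMeasure γ] :
    ((μ.prod γ).map fun p : ℝ × ℝ ↦ (p.1 + p.2, p.1)).fst = μ.conv γ := by
  rw [Measure.fst, Measure.map_map measurable_fst (by fun_prop)]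
  rfl

/-- If adding independent noise does not decrease the divergence, then the density of the first
measure with respect to the second is a function of the noisy observation. -/
theorem rnDeriv_ae_eq_rnDeriv_conv (μ ν γ : Measure ℝ)
    [IsProbabilityMeasure μ] [IsProbabilityMeasure ν] [IsProbabilityMeasure γ]
    (hfin : InformationTheory.klDiv μ ν ≠ ∞)
    (h : InformationTheory.klDiv μ ν ≤ InformationTheory.klDiv (μ.conv γ) (ν.conv γ)) :
    ∀ᵐ p ∂(ν.prod γ), μ.rnDeriv ν p.1 = (μ.conv γ).rnDeriv (ν.conv γ) (p.1 + p.2) := by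
  set g : ℝ × ℝ → ℝ × ℝ := fun p ↦ (p.1 + p.2, p.1) with hg_def
  have hg : Measurable g := by fun_prop
  have hg_emb : MeasurableEmbedding g := by
    refine hg.measurableEmbedding fun p q hpq ↦ ?_
    simp only [hg_def, Prod.mk.injEq] at hpq
    ext <;> linarith [hpq.1, hpq.2]
  have hle := klDiv_map_add_fst_le μ ν γ
  rw [← hg_def] at hle
  have hμ1 : ((μ.prod γ).map g).fst = μ.conv γ := fst_map_add_fst μ γ
  have hν1 : ((ν.prod γ).map g).fst = ν.conv γ := fst_map_add_fst ν γ
  have : IsProbabilityMeasure ((μ.prod γ).map g) :=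
    Measure.isProbabilityMeasure_map hg.aemeasurable
  have : IsProbabilityMeasure ((ν.prod γ).map g) :=
    Measure.isProbabilityMeasure_map hg.aemeasurable
  obtain ⟨κ, hκ_markov, hκ⟩ : ∃ κ : Kernel ℝ ℝ, IsMarkovKernel κ ∧
      (μ.conv γ) ⊗ₘ κ = (μ.prod γ).map g :=
    ⟨((μ.prod γ).map g).condKernel, inferInstance, by rw [← hμ1, Measure.disintegrate]⟩
  obtain ⟨η, hη_markov, hη⟩ : ∃ η : Kernel ℝ ℝ, IsMarkovKernel η ∧
      (ν.conv γ) ⊗ₘ η = (ν.prod γ).map g :=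
    ⟨((ν.prod γ).map g).condKernel, inferInstance, by rw [← hν1, Measure.disintegrate]⟩
  have hconv_fin : InformationTheory.klDiv (μ.conv γ) (ν.conv γ) ≠ ∞ := by
    refine ne_top_of_le_ne_top hfin (le_trans ?_ hle)
    rw [← hκ, ← hη, InformationTheory.klDiv_compProd_eq_add]
    exact le_self_add
  have hzero : InformationTheory.klDiv ((μ.conv γ) ⊗ₘ κ) ((μ.conv γ) ⊗ₘ η) = 0 := by
    have hsum := hle.trans h
    rw [← hκ, ← hη, InformationTheory.klDiv_compProd_eq_add] at hsum
    have := ENNReal.le_of_add_le_add_left hconv_fin (hsum.trans_eq (add_zero _).symm)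
    exact le_antisymm this bot_le
  have hκη : (μ.prod γ).map g = (μ.conv γ) ⊗ₘ η :=
    hκ.symm.trans (InformationTheory.klDiv_eq_zero_iff.mp hzero)
  have h1 := rnDeriv_measure_compProd_left (μ.conv γ) (ν.conv γ) η
  rw [hη, ← hκη] at h1
  have h2 := ae_of_ae_map hg.aemeasurable h1
  have h3 := hg_emb.rnDeriv_map (μ.prod γ) (ν.prod γ)
  have h4 := rnDeriv_measure_compProd_left μ ν (Kernel.const ℝ γ)
  simp only [Measure.compProd_const] at h4
  filter_upwards [h2, h3, h4] with p hp2 hp3 hp4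
  rw [← hp4, ← hp3, hp2]

theorem eq_of_rnDeriv_ae_eq_comp_add {μ ν γ : Measure ℝ}
    [IsProbabilityMeasure μ] [IsProbabilityMeasure ν] [IsProbabilityMeasure γ]
    (hμν : μ ≪ ν) (hγ : volume ≪ γ) {h : ℝ → ℝ≥0∞}
    (hh : ∀ᵐ p ∂(ν.prod γ), μ.rnDeriv ν p.1 = h (p.1 + p.2)) : μ = ν := by
  have hae : ∀ᵐ x ∂ν, ∀ᵐ z ∂(volume : Measure ℝ), μ.rnDeriv ν x = h z := by
    filter_upwards [Measure.ae_ae_of_ae_prod hh] with x hx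
    have hx' := (quasiMeasurePreserving_add_left (volume : Measure ℝ) (-x)).ae (hγ.ae_le hx)
    filter_upwards [hx'] with z hz
    simpa using hz
  obtain ⟨x₀, hx₀⟩ := hae.exists
  have hconst : μ.rnDeriv ν =ᵐ[ν] fun _ ↦ μ.rnDeriv ν x₀ := by
    filter_upwards [hae] with x hx
    obtain ⟨z, hz, hz₀⟩ := (hx.and hx₀).exists
    rw [hz, hz₀]
  have hμ : μ = μ.rnDeriv ν x₀ • ν := by
    rw [← withDensity_const, ← withDensity_congr_ae hconst, Measure.withDensity_rnDeriv_eq _ _ hμν]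
  have hone : μ.rnDeriv ν x₀ = 1 := by
    simpa using (congrArg (fun m : Measure ℝ ↦ m Set.univ) hμ).symm
  rw [hμ, hone, one_smul]

/-- Adding independent noise whose law dominates Lebesgue measure strictly decreases a finite
divergence between distinct probability measures. -/
theorem klDiv_conv_lt {μ ν γ : Measure ℝ}
    [IsProbabilityMeasure μ] [IsProbabilityMeasure ν] [IsProbabilityMeasure γ]
    (hγ : volume ≪ γ) (hμν : μ ≠ ν) (hfin : klDiv μ ν < ⊤) :
    klDiv (μ.conv γ) (ν.conv γ) < klDiv μ ν := by
  rw [klDiv_eq_coe_klDiv] at hfin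
  rw [klDiv_eq_coe_klDiv, klDiv_eq_coe_klDiv, EReal.coe_ennreal_lt_coe_ennreal_iff]
  have hne : InformationTheory.klDiv μ ν ≠ ∞ := by
    intro htop
    simp [htop] at hfin
  by_contra! hle
  refine hμν (eq_of_rnDeriv_ae_eq_comp_add (InformationTheory.klDiv_ne_top_iff.mp hne).1
    hγ (rnDeriv_ae_eq_rnDeriv_conv μ ν γ hne hle))

/-- Strict decrease of the Kullback–Leibler divergence under Gaussian smoothing: if the two
probability measures are distinct and their KL divergence is finite, then adding the same
Gaussian noise (mean 0, variance σ²) strictly decreases the divergence. -/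
theorem klDiv_conv_gaussian_lt (σ : ℝ) (hσ : 0 < σ)
    (μ ν : Measure ℝ) [IsProbabilityMeasure μ] [IsProbabilityMeasure ν]
    (hμν : μ ≠ ν) (hfin : klDiv μ ν < ⊤) :
    klDiv (μ.conv (gaussianReal 0 ⟨σ ^ 2, sq_nonneg σ⟩))
        (ν.conv (gaussianReal 0 ⟨σ ^ 2, sq_nonneg σ⟩)) < klDiv μ ν := by
  have hv : (⟨σ ^ 2, sq_nonneg σ⟩ : NNReal) ≠ 0 :=
    fun h0 ↦ (pow_pos hσ 2).ne' (congrArg NNReal.toReal h0)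
  have : IsProbabilityMeasure (gaussianReal 0 ⟨σ ^ 2, sq_nonneg σ⟩) :=
    instIsProbabilityMeasureGaussianReal 0 _
  exact klDiv_conv_lt (gaussianReal_absolutelyContinuous' 0 hv) hμν hfin
end

section
/- Let 0 < s ≤ t and let γ_r denote the Gaussian probability measure on ℝ with mean 0 and variance r². For any probability measures μ and ν on ℝ, KL(μ ∗ γ_t ‖ ν ∗ γ_t) ≤ KL(μ ∗ γ_s ‖ ν ∗ γ_s). (The KL divergence between the Gaussian-noised laws is nonincreasing in the noise level; this is the key step in the second part of the paper's Theorem 1, and follows since γ_t equals γ_s convolved with a further Gaussian of variance t² − s².) -/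
open MeasureTheory ProbabilityTheory

theorem klDiv_eq_coe_informationTheory_klDiv {α : Type*} [MeasurableSpace α] (μ ν : Measure α)
    [IsProbabilityMeasure μ] [IsProbabilityMeasure ν] :
    klDiv μ ν = (InformationTheory.klDiv μ ν : EReal) := by
  by_cases h : μ ≪ ν ∧ Integrable (llr μ ν) μ
  · rw [klDiv, if_pos h, ← InformationTheory.toReal_klDiv_of_measure_eq h.1 (by simp),
      EReal.coe_ennreal_toReal (InformationTheory.klDiv_ne_top h.1 h.2)]
  · rw [klDiv, if_neg h, InformationTheory.klDiv_eq_top_iff.mpr fun h₁ h₂ ↦ h ⟨h₁, h₂⟩,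
      EReal.coe_ennreal_top]

theorem informationTheory_klDiv_conv_right_le {M : Type*} [AddMonoid M] [MeasurableSpace M]
    [MeasurableAdd₂ M] (μ ν ρ : Measure M) [IsFiniteMeasure μ] [IsFiniteMeasure ν]
    [IsProbabilityMeasure ρ] :
    InformationTheory.klDiv (μ.conv ρ) (ν.conv ρ) ≤ InformationTheory.klDiv μ ν := by
  calc InformationTheory.klDiv (μ.conv ρ) (ν.conv ρ)
      ≤ InformationTheory.klDiv (μ.prod ρ) (ν.prod ρ) :=
        InformationTheory.klDiv_map_le _ _ measurable_add
    _ = InformationTheory.klDiv μ ν := by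
        rw [← Measure.compProd_const, ← Measure.compProd_const,
          InformationTheory.klDiv_compProd_left]

theorem klDiv_conv_gaussianReal_le (μ ν : Measure ℝ) [IsProbabilityMeasure μ]
    [IsProbabilityMeasure ν] (m : ℝ) {v w : NNReal} (hvw : v ≤ w) :
    klDiv (μ.conv (gaussianReal m w)) (ν.conv (gaussianReal m w)) ≤
      klDiv (μ.conv (gaussianReal m v)) (ν.conv (gaussianReal m v)) := by
  have hconv : gaussianReal m w = (gaussianReal m v).conv (gaussianReal 0 (w - v)) := by
    rw [gaussianReal_conv_gaussianReal, add_zero, add_tsub_cancel_of_le hvw]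
  rw [klDiv_eq_coe_informationTheory_klDiv, klDiv_eq_coe_informationTheory_klDiv,
    EReal.coe_ennreal_le_coe_ennreal_iff, hconv, ← Measure.conv_assoc, ← Measure.conv_assoc]
  exact informationTheory_klDiv_conv_right_le _ _ _

/-- The Kullback–Leibler divergence between Gaussian-noised laws is nonincreasing in the
noise level: for noise levels 0 < s ≤ t, noising at level t gives a KL divergence at most
that obtained by noising at level s. -/
theorem klDiv_conv_gaussian_anti (s t : ℝ) (hs : 0 < s) (hst : s ≤ t)
    (μ ν : Measure ℝ) [IsProbabilityMeasure μ] [IsProbabilityMeasure ν] :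
    klDiv (μ.conv (gaussianReal 0 ⟨t ^ 2, sq_nonneg t⟩))
        (ν.conv (gaussianReal 0 ⟨t ^ 2, sq_nonneg t⟩)) ≤
      klDiv (μ.conv (gaussianReal 0 ⟨s ^ 2, sq_nonneg s⟩))
        (ν.conv (gaussianReal 0 ⟨s ^ 2, sq_nonneg s⟩)) := by
  exact klDiv_conv_gaussianReal_le μ ν 0 (show s ^ 2 ≤ t ^ 2 by gcongr)
end

section
/- Let (Ω, 𝒫) be a probability space, let X : Ω → ℝ be a random variable with law ν, let Z : Ω → ℝ be independent of X with law γ_σ (Gaussian, mean 0, variance σ², σ > 0), and let κ = condDistrib X (X+Z) be the regular conditional distribution of X given X + Z. Then for every probability measure μ on ℝ, KL((μ ∗ γ_σ).bind κ ‖ ν) ≤ KL(μ ‖ ν). (The paper's Theorem 1 with the denoiser Φ taken to be the exact stochastic denoiser: the 'add Gaussian noise, then apply the exact posterior denoising kernel of the source distribution' procedure does not increase the KL divergence to the source distribution ν, for any decoded-image distribution μ.) -/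
open MeasureTheory ProbabilityTheory

/-- Adding independent noise and then applying the posterior kernel of the signal given the noisy
observation does not increase the Kullback–Leibler divergence to the law of the signal. -/
theorem klDiv_bind_condDistrib_conv_le {Ω E : Type*} [MeasurableSpace Ω]
    [AddMonoid E] [MeasurableSpace E] [MeasurableAdd₂ E] [StandardBorelSpace E] {P : Measure Ω}
    [IsProbabilityMeasure P] {X Z : Ω → E} (hX : Measurable X) (hZ : Measurable Z)
    (hindep : IndepFun X Z P) (μ : Measure E) [IsProbabilityMeasure μ] :
    klDiv ((μ.conv (P.map Z)).bind (condDistrib X (fun ω => X ω + Z ω) P)) (P.map X) ≤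
      klDiv μ (P.map X) := by
  have := Measure.isProbabilityMeasure_map (μ := P) hX.aemeasurable
  have := Measure.isProbabilityMeasure_map (μ := P) hZ.aemeasurable
  have hbind : ((P.map X).conv (P.map Z)).bind (condDistrib X (fun ω => X ω + Z ω) P) =
      P.map X := by
    rw [← hindep.map_add_eq_map_conv_map hX hZ]
    exact condDistrib_comp_map (hX.add hZ).aemeasurable hX.aemeasurable
  rw [klDiv_eq_coe_informationTheory_klDiv, klDiv_eq_coe_informationTheory_klDiv,
    EReal.coe_ennreal_le_coe_ennreal_iff]
  nth_rw 1 [← hbind]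
  exact (InformationTheory.klDiv_comp_right_le _ _ _).trans
    (informationTheory_klDiv_conv_right_le _ _ _)

/-- Theorem 1 of the paper with the exact stochastic denoiser: adding Gaussian noise of
variance σ² and then applying the exact posterior denoising kernel of the source
distribution ν does not increase the KL divergence to ν, for any probability measure μ. -/
theorem klDiv_bind_condDistrib_conv_gaussian_le {Ω : Type*} [MeasurableSpace Ω]
    (P : Measure Ω) [IsProbabilityMeasure P] (σ : ℝ) (hσ : 0 < σ)
    (X Z : Ω → ℝ) (hX : Measurable X) (hZ : Measurable Z)
    (hindep : IndepFun X Z P) (ν : Measure ℝ) (hXlaw : P.map X = ν)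
    (hZlaw : P.map Z = gaussianReal 0 ⟨σ ^ 2, sq_nonneg σ⟩)
    (μ : Measure ℝ) [IsProbabilityMeasure μ] :
    klDiv ((μ.conv (gaussianReal 0 ⟨σ ^ 2, sq_nonneg σ⟩)).bind
        (condDistrib X (fun ω => X ω + Z ω) P)) ν ≤ klDiv μ ν := by
  rw [← hXlaw, ← hZlaw]
  exact klDiv_bind_condDistrib_conv_le hX hZ hindep μ
end

section
/- Tweedie's formula on ℝ: Let σ > 0, let φ_σ(u) = (2πσ²)^{-1/2} exp(−u²/(2σ²)) be the Gaussian density, and let μ be any probability measure on ℝ. Define p(y) = ∫ φ_σ(y − x) dμ(x). Then for every y ∈ ℝ: (i) p(y) > 0; (ii) p is differentiable at y; (iii) the posterior mean satisfies ∫ x · φ_σ(y − x) dμ(x) = p(y) · (y + σ² · p'(y)/p(y)). Equivalently, if X ~ μ and Z ~ N(0, σ²) are independent, then E[X | X + Z = y] = y + σ² (d/dy) log p(y). -/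
open MeasureTheory ProbabilityTheory

/-- The Gaussian density on ℝ with mean 0 and variance σ²:
`φ_σ(u) = (2πσ²)^(-1/2) * exp(-u²/(2σ²))`. -/
noncomputable def gaussianDensity (σ : ℝ) (u : ℝ) : ℝ :=
  (Real.sqrt (2 * Real.pi * σ ^ 2))⁻¹ * Real.exp (-(u ^ 2) / (2 * σ ^ 2))

/-- The density of the Gaussian-smoothed measure: `p(y) = ∫ φ_σ(y - x) dμ(x)`, the density of
the law of `X + Z` with `X ~ μ` and `Z ~ N(0, σ²)` independent. -/
noncomputable def smoothedDensity (σ : ℝ) (μ : Measure ℝ) (y : ℝ) : ℝ :=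
  ∫ x, gaussianDensity σ (y - x) ∂μ

theorem continuous_gaussianDensity (σ : ℝ) : Continuous (gaussianDensity σ) := by
  unfold gaussianDensity
  fun_prop

theorem gaussianDensity_pos {σ : ℝ} (hσ : 0 < σ) (u : ℝ) : 0 < gaussianDensity σ u := by
  unfold gaussianDensity
  positivity

theorem gaussianDensity_le (σ u : ℝ) :
    gaussianDensity σ u ≤ (Real.sqrt (2 * Real.pi * σ ^ 2))⁻¹ := by
  refine mul_le_of_le_one_right (by positivity) (Real.exp_le_one_iff.2 ?_)
  rw [neg_div]
  exact neg_nonpos.2 (by positivity)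

theorem hasDerivAt_gaussianDensity (σ u : ℝ) :
    HasDerivAt (gaussianDensity σ) (-(u / σ ^ 2) * gaussianDensity σ u) u := by
  have h : HasDerivAt (fun v : ℝ => -(v ^ 2) / (2 * σ ^ 2)) (-(2 * u) / (2 * σ ^ 2)) u := by
    simpa using ((hasDerivAt_pow 2 u).neg.div_const (2 * σ ^ 2))
  refine (h.exp.const_mul (Real.sqrt (2 * Real.pi * σ ^ 2))⁻¹).congr_deriv ?_
  rw [neg_div _ (2 * u), mul_div_mul_left u (σ ^ 2) two_ne_zero, gaussianDensity]
  ring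

theorem abs_mul_gaussianDensity_le {σ : ℝ} (hσ : 0 < σ) (u : ℝ) :
    |u| * gaussianDensity σ u ≤ σ * (Real.sqrt (2 * Real.pi * σ ^ 2))⁻¹ := by
  have h : |u| ≤ σ * Real.exp (u ^ 2 / (2 * σ ^ 2)) :=
    calc |u| ≤ σ * (u ^ 2 / (2 * σ ^ 2) + 1) := by
          have : σ * (u ^ 2 / (2 * σ ^ 2) + 1) - |u| = ((|u| - σ) ^ 2 + σ ^ 2) / (2 * σ) := by
            rw [← sq_abs u]
            field_simp
            ring
          have : 0 ≤ ((|u| - σ) ^ 2 + σ ^ 2) / (2 * σ) := by positivity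
          linarith
      _ ≤ _ := by gcongr; exact Real.add_one_le_exp _
  have h' : |u| * Real.exp (-(u ^ 2) / (2 * σ ^ 2)) ≤ σ := by
    rwa [neg_div, Real.exp_neg, ← div_eq_mul_inv, div_le_iff₀ (Real.exp_pos _)]
  rw [gaussianDensity, mul_left_comm, mul_comm σ]
  gcongr

theorem integrable_gaussianDensity_sub {σ : ℝ} (hσ : 0 < σ) (μ : Measure ℝ) [IsFiniteMeasure μ]
    (y : ℝ) : Integrable (fun x => gaussianDensity σ (y - x)) μ := by
  refine .of_bound ((continuous_gaussianDensity σ).comp (by fun_prop)).aestronglyMeasurable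
    (Real.sqrt (2 * Real.pi * σ ^ 2))⁻¹ (.of_forall fun x => ?_)
  rw [Real.norm_of_nonneg (gaussianDensity_pos hσ _).le]
  exact gaussianDensity_le σ _

theorem smoothedDensity_pos {σ : ℝ} (hσ : 0 < σ) (μ : Measure ℝ) [IsFiniteMeasure μ] [NeZero μ]
    (y : ℝ) : 0 < smoothedDensity σ μ y := by
  refine (integral_pos_iff_support_of_nonneg (fun x => (gaussianDensity_pos hσ _).le)
    (integrable_gaussianDensity_sub hσ μ y)).2 ?_
  rw [Function.support_eq_univ fun x => (gaussianDensity_pos hσ _).ne']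
  exact Measure.measure_univ_pos.2 (NeZero.ne μ)

theorem hasDerivAt_smoothedDensity {σ : ℝ} (hσ : 0 < σ) (μ : Measure ℝ) [IsFiniteMeasure μ]
    (y : ℝ) :
    Integrable (fun x => -((y - x) / σ ^ 2) * gaussianDensity σ (y - x)) μ ∧
      HasDerivAt (smoothedDensity σ μ)
        (∫ x, -((y - x) / σ ^ 2) * gaussianDensity σ (y - x) ∂μ) y := by
  have hc := continuous_gaussianDensity σ
  refine hasDerivAt_integral_of_dominated_loc_of_deriv_le
    (F := fun y x => gaussianDensity σ (y - x))
    (F' := fun y x => -((y - x) / σ ^ 2) * gaussianDensity σ (y - x))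
    (bound := fun _ => σ * (Real.sqrt (2 * Real.pi * σ ^ 2))⁻¹ / σ ^ 2)
    Filter.univ_mem
    (.of_forall fun z => (integrable_gaussianDensity_sub hσ μ z).aestronglyMeasurable)
    (integrable_gaussianDensity_sub hσ μ y)
    (Continuous.aestronglyMeasurable (by fun_prop))
    (.of_forall fun x z _ => ?_) (integrable_const _)
    (.of_forall fun x z _ => (hasDerivAt_gaussianDensity σ (z - x)).comp_sub_const z x)
  rw [norm_mul, norm_neg, norm_div, Real.norm_of_nonneg (gaussianDensity_pos hσ _).le,
    Real.norm_of_nonneg (sq_nonneg σ), Real.norm_eq_abs, div_mul_eq_mul_div]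
  exact div_le_div_of_nonneg_right (abs_mul_gaussianDensity_le hσ _) (sq_nonneg σ)

/-- Tweedie's formula on ℝ: for any probability measure μ and any `y`, the smoothed density
`p(y) = ∫ φ_σ(y - x) dμ(x)` is positive and differentiable at `y`, and the (unnormalized)
posterior mean satisfies `∫ x · φ_σ(y − x) dμ(x) = p(y) · (y + σ² · p'(y)/p(y))`, i.e.
`E[X | X + Z = y] = y + σ² (log p)'(y)`. -/
theorem tweedie_formula (σ : ℝ) (hσ : 0 < σ) (μ : Measure ℝ) [IsProbabilityMeasure μ]
    (y : ℝ) :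
    0 < smoothedDensity σ μ y ∧
      DifferentiableAt ℝ (smoothedDensity σ μ) y ∧
      ∫ x, x * gaussianDensity σ (y - x) ∂μ =
        smoothedDensity σ μ y *
          (y + σ ^ 2 * (deriv (smoothedDensity σ μ) y / smoothedDensity σ μ y)) := by
  obtain ⟨hint, hder⟩ := hasDerivAt_smoothedDensity hσ μ y
  have hpos := smoothedDensity_pos hσ μ y
  refine ⟨hpos, hder.differentiableAt, ?_⟩
  calc ∫ x, x * gaussianDensity σ (y - x) ∂μ
      = ∫ x, (y * gaussianDensity σ (y - x) +
          σ ^ 2 * (-((y - x) / σ ^ 2) * gaussianDensity σ (y - x))) ∂μ := by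
        congr with x
        field_simp
        ring
    _ = y * smoothedDensity σ μ y + σ ^ 2 * deriv (smoothedDensity σ μ) y := by
        rw [integral_add ((integrable_gaussianDensity_sub hσ μ y).const_mul y)
          (hint.const_mul _), integral_const_mul, integral_const_mul, hder.deriv, smoothedDensity]
    _ = _ := by
        field_simp
end

section
/- De Bruijn-type identity for relative entropy under Gaussian smoothing: Let μ and ν be compactly supported probability measures on ℝ. For t > 0 define p_t(y) = ∫ φ_{√t}(y − x) dμ(x) and q_t(y) = ∫ φ_{√t}(y − x) dν(x), where φ_σ(u) = (2πσ²)^{-1/2} exp(−u²/(2σ²)). Then for every t > 0, the function t ↦ ∫ p_t(y) log(p_t(y)/q_t(y)) dy is differentiable at t with derivative −(1/2) ∫ p_t(y) · (p_t'(y)/p_t(y) − q_t'(y)/q_t(y))² dy. (This is the identity, used via Eq. (bsde), expressing that the KL divergence along the Gaussian noising flow decreases at rate given by the Fisher divergence, underlying the strict contraction of the SDE denoiser in the paper's Theorem 1.) -/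
open MeasureTheory ProbabilityTheory

/-- The density at time `t` of the Gaussian noising flow started at μ:
`p_t(y) = ∫ φ_{√t}(y − x) dμ(x)`, the density of the law of `X + √t·Z` with `X ~ μ`,
`Z ~ N(0,1)` independent. -/
noncomputable def heatDensity (μ : Measure ℝ) (t : ℝ) (y : ℝ) : ℝ :=
  ∫ x, gaussianDensity (Real.sqrt t) (y - x) ∂μ

open Set Filter Topology

/-- Differentiation under the integral sign for a finite measure carried by a bounded set, when
the integrand is continuously differentiable in the parameter. -/
theorem hasDerivAt_integral_of_ae_abs_le {μ : Measure ℝ} [IsFiniteMeasure μ] {R : ℝ}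
    (hR : ∀ᵐ x ∂μ, |x| ≤ R) {f f' : ℝ → ℝ → ℝ} {a b z₀ : ℝ} (hz : z₀ ∈ Ioo a b)
    (hf : ∀ z ∈ Icc a b, Continuous (f z))
    (hf' : ContinuousOn (Function.uncurry f') (Icc a b ×ˢ univ))
    (hd : ∀ z ∈ Icc a b, ∀ x, HasDerivAt (fun w => f w x) (f' z x) z) :
    HasDerivAt (fun z => ∫ x, f z x ∂μ) (∫ x, f' z₀ x ∂μ) z₀ := by
  have hK : IsCompact (Icc a b ×ˢ Icc (-R) R) := isCompact_Icc.prod isCompact_Icc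
  obtain ⟨C, hC⟩ := hK.exists_bound_of_continuousOn
    (hf'.mono (prod_mono_right (subset_univ _)))
  have hz' : z₀ ∈ Icc a b := Ioo_subset_Icc_self hz
  obtain ⟨C₀, hC₀⟩ := (isCompact_Icc (a := -R) (b := R)).exists_bound_of_continuousOn
    (hf z₀ hz').continuousOn
  have hcont' : Continuous (f' z₀) := by
    have : ContinuousOn (fun x => Function.uncurry f' (z₀, x)) univ :=
      hf'.comp (by fun_prop) (fun x _ => ⟨hz', mem_univ x⟩)
    simpa [continuousOn_univ] using this
  refine (hasDerivAt_integral_of_dominated_loc_of_deriv_le (bound := fun _ => C)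
    (Icc_mem_nhds hz.1 hz.2) ?_ ?_ hcont'.aestronglyMeasurable ?_ (integrable_const C) ?_).2
  · filter_upwards [Icc_mem_nhds hz.1 hz.2] with z hz
    exact (hf z hz).aestronglyMeasurable
  · refine Integrable.of_bound (hf z₀ hz').aestronglyMeasurable C₀ ?_
    filter_upwards [hR] with x hx
    exact hC₀ x (abs_le.mp hx)
  · filter_upwards [hR] with x hx z hz
    exact hC (z, x) ⟨hz, abs_le.mp hx⟩
  · exact Eventually.of_forall fun x z hz => hd z hz x

/-- The kernel `exp (-u² / (2s)) / √(2πs)`, parametrised by the variance `s`. -/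
noncomputable def heatKernel (s u : ℝ) : ℝ :=
  (Real.sqrt (2 * Real.pi * s))⁻¹ * Real.exp (-(u ^ 2) / (2 * s))

theorem gaussianDensity_sqrt {s : ℝ} (hs : 0 ≤ s) (u : ℝ) :
    gaussianDensity (Real.sqrt s) u = heatKernel s u := by
  simp only [gaussianDensity, heatKernel, Real.sq_sqrt hs]

theorem heatKernel_pos {s : ℝ} (hs : 0 < s) (u : ℝ) : 0 < heatKernel s u := by
  unfold heatKernel; positivity

@[fun_prop]
theorem continuous_heatKernel (s : ℝ) : Continuous (heatKernel s) := by
  unfold heatKernel; fun_prop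

theorem hasDerivAt_heatKernel_space {s : ℝ} (hs : 0 < s) (u : ℝ) :
    HasDerivAt (heatKernel s) (-(u / s) * heatKernel s u) u := by
  have h := (((((hasDerivAt_id u).pow 2).neg.div_const (2 * s)).exp).const_mul
    (Real.sqrt (2 * Real.pi * s))⁻¹)
  refine h.congr_deriv ?_
  simp [heatKernel]
  field_simp

theorem hasDerivAt_heatKernel_space_deriv {s : ℝ} (hs : 0 < s) (u : ℝ) :
    HasDerivAt (fun u => -(u / s) * heatKernel s u)
      ((u ^ 2 / s ^ 2 - 1 / s) * heatKernel s u) u := by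
  have h := (((hasDerivAt_id u).div_const s).neg).mul (hasDerivAt_heatKernel_space hs u)
  refine h.congr_deriv ?_
  simp
  field_simp
  ring

theorem hasDerivAt_heatKernel_time {s : ℝ} (hs : 0 < s) (u : ℝ) :
    HasDerivAt (fun s => heatKernel s u)
      (1 / 2 * ((u ^ 2 / s ^ 2 - 1 / s) * heatKernel s u)) s := by
  have hne : 2 * Real.pi * s ≠ 0 := by positivity
  have h1 := (((hasDerivAt_id s).const_mul (2 * Real.pi)).sqrt hne).inv
    (Real.sqrt_ne_zero'.mpr (by simp only [id]; positivity))
  have h2 := (((hasDerivAt_const s (-(u ^ 2))).div ((hasDerivAt_id s).const_mul 2)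
    (by simp only [id]; positivity))).exp
  refine (h1.mul h2).congr_deriv ?_
  have h3 : Real.sqrt (2 * Real.pi * s) ^ 2 = 2 * Real.pi * s := Real.sq_sqrt (by positivity)
  have h4 : Real.sqrt (2 * Real.pi * s) ≠ 0 := by positivity
  simp only [heatKernel, id, h3, Pi.div_apply, Pi.inv_apply]
  field_simp
  ring

theorem continuousOn_uncurry_heatKernel :
    ContinuousOn (Function.uncurry heatKernel) (Ioi 0 ×ˢ univ) := by
  unfold heatKernel
  rintro ⟨s, u⟩ ⟨hs, -⟩
  have hs : 0 < s := hs
  apply ContinuousAt.continuousWithinAt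
  simp only [Function.uncurry_def]
  have h4 : Real.sqrt (2 * Real.pi * s) ≠ 0 := by positivity
  have h5 : 2 * s ≠ 0 := by positivity
  fun_prop (disch := assumption)

/-- The integral of `w (y - x)` times the heat kernel; for suitable weights these are the
derivatives of the heat flow. -/
noncomputable def heatMoment (w : ℝ → ℝ) (μ : Measure ℝ) (s y : ℝ) : ℝ :=
  ∫ x, w (y - x) * heatKernel s (y - x) ∂μ

theorem integrable_mul_heatKernel {μ : Measure ℝ} [IsFiniteMeasure μ] {R : ℝ}
    (hR : ∀ᵐ x ∂μ, |x| ≤ R) {w : ℝ → ℝ} (hw : Continuous w) (s y : ℝ) :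
    Integrable (fun x => w (y - x) * heatKernel s (y - x)) μ := by
  have hc : Continuous (fun x => w (y - x) * heatKernel s (y - x)) := by fun_prop
  obtain ⟨C, hC⟩ := (isCompact_Icc (a := -R) (b := R)).exists_bound_of_continuousOn
    hc.continuousOn
  refine Integrable.of_bound hc.aestronglyMeasurable C ?_
  filter_upwards [hR] with x hx
  exact hC x (abs_le.mp hx)

theorem integrable_heatKernel {μ : Measure ℝ} [IsFiniteMeasure μ] {R : ℝ}
    (hR : ∀ᵐ x ∂μ, |x| ≤ R) (s y : ℝ) :
    Integrable (fun x => heatKernel s (y - x)) μ := by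
  simpa using integrable_mul_heatKernel hR (w := fun _ => 1) continuous_const s y

theorem heatDensity_eq {μ : Measure ℝ} {s : ℝ} (hs : 0 ≤ s) (y : ℝ) :
    heatDensity μ s y = ∫ x, heatKernel s (y - x) ∂μ := by
  simp only [heatDensity, gaussianDensity_sqrt hs]

/-- The first space derivative of the heat flow. -/
noncomputable def heatDensityDeriv (μ : Measure ℝ) (s y : ℝ) : ℝ :=
  heatMoment (fun u => -(u / s)) μ s y

/-- The second space derivative of the heat flow. -/
noncomputable def heatDensityDeriv₂ (μ : Measure ℝ) (s y : ℝ) : ℝ :=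
  heatMoment (fun u => u ^ 2 / s ^ 2 - 1 / s) μ s y

theorem hasDerivAt_heatDensity_space {μ : Measure ℝ} [IsFiniteMeasure μ] {R : ℝ}
    (hR : ∀ᵐ x ∂μ, |x| ≤ R) {s : ℝ} (hs : 0 < s) (y : ℝ) :
    HasDerivAt (heatDensity μ s) (heatDensityDeriv μ s y) y := by
  rw [show heatDensity μ s = fun y => ∫ x, heatKernel s (y - x) ∂μ from
    funext (heatDensity_eq hs.le)]
  refine hasDerivAt_integral_of_ae_abs_le hR (a := y - 1) (b := y + 1)
    (f := fun y x => heatKernel s (y - x))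
    (f' := fun y x => -((y - x) / s) * heatKernel s (y - x))
    ⟨by linarith, by linarith⟩ (fun z _ => by fun_prop)
    (by simp only [Function.uncurry_def]; fun_prop) fun z _ x => ?_
  simpa [Function.comp_def] using (hasDerivAt_heatKernel_space hs (z - x)).comp z ((hasDerivAt_id z).sub_const x)

theorem hasDerivAt_heatDensityDeriv {μ : Measure ℝ} [IsFiniteMeasure μ] {R : ℝ}
    (hR : ∀ᵐ x ∂μ, |x| ≤ R) {s : ℝ} (hs : 0 < s) (y : ℝ) :
    HasDerivAt (heatDensityDeriv μ s) (heatDensityDeriv₂ μ s y) y := by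
  unfold heatDensityDeriv heatDensityDeriv₂ heatMoment
  refine hasDerivAt_integral_of_ae_abs_le hR (a := y - 1) (b := y + 1)
    (f := fun y x => -((y - x) / s) * heatKernel s (y - x))
    (f' := fun y x => ((y - x) ^ 2 / s ^ 2 - 1 / s) * heatKernel s (y - x))
    ⟨by linarith, by linarith⟩ (fun z _ => by fun_prop)
    (by simp only [Function.uncurry_def]; fun_prop) fun z _ x => ?_
  simpa [Function.comp_def] using (hasDerivAt_heatKernel_space_deriv hs (z - x)).comp z
    ((hasDerivAt_id z).sub_const x)

/-- The heat equation. -/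
theorem hasDerivAt_heatDensity_time {μ : Measure ℝ} [IsFiniteMeasure μ] {R : ℝ}
    (hR : ∀ᵐ x ∂μ, |x| ≤ R) {s : ℝ} (hs : 0 < s) (y : ℝ) :
    HasDerivAt (fun r => heatDensity μ r y) (1 / 2 * heatDensityDeriv₂ μ s y) s := by
  have key : HasDerivAt (fun r => ∫ x, heatKernel r (y - x) ∂μ)
      (∫ x, 1 / 2 * (((y - x) ^ 2 / s ^ 2 - 1 / s) * heatKernel s (y - x)) ∂μ) s := by
    refine hasDerivAt_integral_of_ae_abs_le hR (a := s / 2) (b := s + 1)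
      (f := fun r x => heatKernel r (y - x))
      (f' := fun r x => 1 / 2 * (((y - x) ^ 2 / r ^ 2 - 1 / r) * heatKernel r (y - x)))
      ⟨by linarith, by linarith⟩ (fun z _ => by fun_prop) ?_
      fun z hz x => hasDerivAt_heatKernel_time (by linarith [hz.1]) (y - x)
    have hk : ContinuousOn (fun p : ℝ × ℝ => heatKernel p.1 (y - p.2))
        (Icc (s / 2) (s + 1) ×ˢ univ) :=
      continuousOn_uncurry_heatKernel.comp
        (f := fun p : ℝ × ℝ => (p.1, y - p.2)) (by fun_prop)
        fun p hp => ⟨lt_of_lt_of_le (by positivity) hp.1.1, mem_univ _⟩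
    have h0 : ∀ p ∈ Icc (s / 2) (s + 1) ×ˢ (univ : Set ℝ), p.1 ≠ 0 := fun p hp =>
      (lt_of_lt_of_le (by positivity) hp.1.1).ne'
    have h1 : ∀ p ∈ Icc (s / 2) (s + 1) ×ˢ (univ : Set ℝ), p.1 ^ 2 ≠ 0 := fun p hp =>
      pow_ne_zero 2 (h0 p hp)
    simp only [Function.uncurry_def]
    fun_prop (disch := assumption)
  rw [integral_const_mul] at key
  refine key.congr_of_eventuallyEq ?_
  filter_upwards [Ioi_mem_nhds hs] with r hr
  exact heatDensity_eq (le_of_lt hr) y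

theorem heatKernel_le {s : ℝ} (hs : 0 < s) {R x : ℝ} (hx : |x| ≤ R) (y : ℝ) :
    heatKernel s (y - x) ≤
      (Real.sqrt (2 * Real.pi * s))⁻¹ * Real.exp ((R ^ 2 - y ^ 2 / 2) / (2 * s)) := by
  unfold heatKernel
  gcongr
  nlinarith [sq_le_sq.mpr (hx.trans (le_abs_self R)), sq_nonneg (y - 2 * x)]

theorem sq_sub_le {R x : ℝ} (hx : |x| ≤ R) (y : ℝ) : (y - x) ^ 2 ≤ 2 * R ^ 2 + 2 * y ^ 2 := by
  nlinarith [sq_le_sq.mpr (hx.trans (le_abs_self R)), sq_nonneg (y + x)]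

theorem le_heatKernel {s : ℝ} (hs : 0 < s) {R x : ℝ} (hx : |x| ≤ R) (y : ℝ) :
    (Real.sqrt (2 * Real.pi * s))⁻¹ * Real.exp (-(2 * R ^ 2 + 2 * y ^ 2) / (2 * s)) ≤
      heatKernel s (y - x) := by
  unfold heatKernel
  gcongr
  exact sq_sub_le hx y

theorem heatDensity_le {μ : Measure ℝ} [IsProbabilityMeasure μ] {R : ℝ}
    (hR : ∀ᵐ x ∂μ, |x| ≤ R) {s : ℝ} (hs : 0 < s) (y : ℝ) :
    heatDensity μ s y ≤
      (Real.sqrt (2 * Real.pi * s))⁻¹ * Real.exp ((R ^ 2 - y ^ 2 / 2) / (2 * s)) := by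
  rw [heatDensity_eq hs.le]
  refine (integral_mono_ae (integrable_heatKernel hR s y) (integrable_const _)
    (hR.mono fun x hx => heatKernel_le hs hx y)).trans_eq ?_
  simp

theorem heatDensity_le_const {μ : Measure ℝ} [IsProbabilityMeasure μ] {R : ℝ}
    (hR : ∀ᵐ x ∂μ, |x| ≤ R) {s : ℝ} (hs : 0 < s) (y : ℝ) :
    heatDensity μ s y ≤ (Real.sqrt (2 * Real.pi * s))⁻¹ := by
  rw [heatDensity_eq hs.le]
  refine (integral_mono (integrable_heatKernel hR s y)
    (integrable_const (Real.sqrt (2 * Real.pi * s))⁻¹) fun x => ?_).trans_eq (by simp)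
  refine mul_le_of_le_one_right (by positivity) (Real.exp_le_one_iff.mpr ?_)
  rw [neg_div, neg_nonpos]
  positivity

theorem le_heatDensity {μ : Measure ℝ} [IsProbabilityMeasure μ] {R : ℝ}
    (hR : ∀ᵐ x ∂μ, |x| ≤ R) {s : ℝ} (hs : 0 < s) (y : ℝ) :
    (Real.sqrt (2 * Real.pi * s))⁻¹ * Real.exp (-(2 * R ^ 2 + 2 * y ^ 2) / (2 * s)) ≤
      heatDensity μ s y := by
  rw [heatDensity_eq hs.le]
  refine Eq.trans_le ?_ (integral_mono_ae (integrable_const _) (integrable_heatKernel hR s y)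
    (hR.mono fun x hx => le_heatKernel hs hx y))
  simp

theorem heatDensity_pos {μ : Measure ℝ} [IsProbabilityMeasure μ] {R : ℝ}
    (hR : ∀ᵐ x ∂μ, |x| ≤ R) {s : ℝ} (hs : 0 < s) (y : ℝ) : 0 < heatDensity μ s y :=
  lt_of_lt_of_le (by positivity) (le_heatDensity hR hs y)

theorem abs_heatMoment_le {μ : Measure ℝ} [IsFiniteMeasure μ] {R : ℝ}
    (hR : ∀ᵐ x ∂μ, |x| ≤ R) {s : ℝ} (hs : 0 < s) {y : ℝ} {w : ℝ → ℝ} {M : ℝ}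
    (hM : ∀ x, |x| ≤ R → |w (y - x)| ≤ M) :
    |heatMoment w μ s y| ≤ M * heatDensity μ s y := by
  rw [heatDensity_eq hs.le, ← integral_const_mul]
  unfold heatMoment
  rw [← Real.norm_eq_abs]
  refine norm_integral_le_of_norm_le ((integrable_heatKernel hR s y).const_mul M) ?_
  filter_upwards [hR] with x hx
  rw [Real.norm_eq_abs, abs_mul, abs_of_pos (heatKernel_pos hs _)]
  exact mul_le_mul_of_nonneg_right (hM x hx) (heatKernel_pos hs _).le

/-- A quadratic weight controlling the logarithmic derivatives of the heat flow of a measure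
carried by `[-R, R]`, at times at least `c⁻¹`. -/
def heatWeight (c R y : ℝ) : ℝ := c ^ 2 * (1 + 2 * R ^ 2 + 2 * y ^ 2)

theorem one_le_heatWeight {c : ℝ} (hc : 1 ≤ c) (R y : ℝ) : 1 ≤ heatWeight c R y := by
  unfold heatWeight
  nlinarith [sq_nonneg R, sq_nonneg y]

theorem abs_heatDensityDeriv_le {μ : Measure ℝ} [IsFiniteMeasure μ] {R : ℝ}
    (hR : ∀ᵐ x ∂μ, |x| ≤ R) {s c : ℝ} (hs : 0 < s) (hc : 1 ≤ c) (hsc : 1 / s ≤ c) (y : ℝ) :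
    |heatDensityDeriv μ s y| ≤ heatWeight c R y * heatDensity μ s y := by
  refine abs_heatMoment_le hR hs fun x hx => ?_
  have h1 := sq_sub_le hx y
  have h2 : |y - x| ≤ 1 + (2 * R ^ 2 + 2 * y ^ 2) := by
    nlinarith [sq_abs (y - x), sq_nonneg (|y - x| - 1), abs_nonneg (y - x)]
  rw [abs_neg, abs_div, abs_of_pos hs, div_eq_mul_one_div, mul_comm, heatWeight, add_assoc]
  gcongr
  nlinarith

theorem abs_heatDensityDeriv₂_le {μ : Measure ℝ} [IsFiniteMeasure μ] {R : ℝ}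
    (hR : ∀ᵐ x ∂μ, |x| ≤ R) {s c : ℝ} (hs : 0 < s) (hc : 1 ≤ c) (hsc : 1 / s ≤ c) (y : ℝ) :
    |heatDensityDeriv₂ μ s y| ≤ heatWeight c R y * heatDensity μ s y := by
  refine abs_heatMoment_le hR hs fun x hx => ?_
  have h1 := sq_sub_le hx y
  have h0 : 0 < 1 / s := by positivity
  have h2 : (y - x) ^ 2 / s ^ 2 ≤ c ^ 2 * (2 * R ^ 2 + 2 * y ^ 2) := by
    rw [div_eq_mul_one_div, mul_comm, ← one_div_pow]
    gcongr
  have h3 : 0 ≤ (y - x) ^ 2 / s ^ 2 := by positivity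
  unfold heatWeight
  rw [abs_le]
  constructor <;> nlinarith [sq_nonneg R, sq_nonneg y, sq_nonneg c]

theorem abs_log_heatDensity_div_le {μ ν : Measure ℝ} [IsProbabilityMeasure μ]
    [IsProbabilityMeasure ν] {R : ℝ} (hμ : ∀ᵐ x ∂μ, |x| ≤ R) (hν : ∀ᵐ x ∂ν, |x| ≤ R)
    {s c : ℝ} (hs : 0 < s) (hc : 1 ≤ c) (hsc : 1 / s ≤ c) (y : ℝ) :
    |Real.log (heatDensity μ s y / heatDensity ν s y)| ≤ heatWeight c R y := by
  have hp := heatDensity_pos hμ hs y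
  have hq := heatDensity_pos hν hs y
  have hk : 0 < (Real.sqrt (2 * Real.pi * s))⁻¹ := by positivity
  have p1 := Real.log_le_log (by positivity) (le_heatDensity hμ hs y)
  have p2 := Real.log_le_log hp (heatDensity_le_const hμ hs y)
  have q1 := Real.log_le_log (by positivity) (le_heatDensity hν hs y)
  have q2 := Real.log_le_log hq (heatDensity_le_const hν hs y)
  rw [Real.log_mul hk.ne' (Real.exp_ne_zero _), Real.log_exp] at p1 q1
  have h0 : 0 < 1 / s := by positivity
  have hw : (2 * R ^ 2 + 2 * y ^ 2) / (2 * s) ≤ heatWeight c R y := by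
    have e : (2 * R ^ 2 + 2 * y ^ 2) / (2 * s) = 1 / s * (R ^ 2 + y ^ 2) := by
      field_simp
    rw [e]
    have h1 : 1 / s ≤ c ^ 2 := by nlinarith
    have h2 : R ^ 2 + y ^ 2 ≤ 1 + 2 * R ^ 2 + 2 * y ^ 2 := by
      nlinarith [sq_nonneg R, sq_nonneg y]
    exact mul_le_mul h1 h2 (by positivity) (by positivity)
  rw [neg_div] at p1 q1
  rw [Real.log_div hp.ne' hq.ne', abs_le]
  constructor <;> linarith

theorem integrable_heatWeight_sq_mul_exp (c R : ℝ) {b : ℝ} (hb : 0 < b) :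
    Integrable fun y => heatWeight c R y ^ 2 * Real.exp (-b * y ^ 2) := by
  have h0 := integrable_exp_neg_mul_sq hb
  have h2 := integrable_rpow_mul_exp_neg_mul_sq hb (s := (2 : ℕ)) (by norm_num)
  have h4 := integrable_rpow_mul_exp_neg_mul_sq hb (s := (4 : ℕ)) (by norm_num)
  simp only [Real.rpow_natCast] at h2 h4
  refine (((h0.const_mul (c ^ 4 * (1 + 2 * R ^ 2) ^ 2)).add
    (h2.const_mul (c ^ 4 * (4 * (1 + 2 * R ^ 2))))).add (h4.const_mul (c ^ 4 * 4))).congr ?_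
  refine Eventually.of_forall fun y => ?_
  simp only [Pi.add_apply, heatWeight]
  ring

theorem heatDensity_le_exp {μ : Measure ℝ} [IsProbabilityMeasure μ] {R : ℝ}
    (hR : ∀ᵐ x ∂μ, |x| ≤ R) {s a b : ℝ} (ha : 0 < a) (hs : s ∈ Icc a b) (y : ℝ) :
    heatDensity μ s y ≤ ((Real.sqrt (2 * Real.pi * a))⁻¹ * Real.exp (R ^ 2 / (2 * a))) *
      Real.exp (-(1 / (4 * b)) * y ^ 2) := by
  obtain ⟨h1, h2⟩ := hs
  have hs : 0 < s := ha.trans_le h1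
  refine (heatDensity_le hR hs y).trans ?_
  rw [mul_assoc _ (Real.exp _), ← Real.exp_add]
  gcongr
  have e : (R ^ 2 - y ^ 2 / 2) / (2 * s) = R ^ 2 / (2 * s) + -(1 / (4 * s) * y ^ 2) := by
    field_simp
    ring
  rw [e, neg_mul]
  gcongr

theorem abs_entropy_term_le {p q a b l L : ℝ} (hp : 0 < p) (hq : 0 < q) (hL : 1 ≤ L)
    (ha : |a| ≤ L * p) (hb : |b| ≤ L * q) (hl : |l| ≤ L) :
    |a * l + a - p * (b / q)| ≤ p * (4 * L ^ 2) := by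
  have hbq : |b / q| ≤ L := by rwa [abs_div, abs_of_pos hq, div_le_iff₀ hq]
  have h1 : |a * l| ≤ L * p * L := by
    rw [abs_mul]
    exact mul_le_mul ha hl (abs_nonneg _) (by positivity)
  have h2 : |p * (b / q)| ≤ p * L := by
    rw [abs_mul, abs_of_pos hp]
    exact mul_le_mul_of_nonneg_left hbq hp.le
  have h3 : p * L ≤ p * L ^ 2 := mul_le_mul_of_nonneg_left (by nlinarith) hp.le
  have h4 := abs_sub (a * l + a) (p * (b / q))
  have h5 := abs_add_le (a * l) a
  nlinarith [mul_nonneg hp.le (sq_nonneg L)]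

theorem abs_fisher_term_le {p q a b L : ℝ} (hp : 0 < p) (hq : 0 < q)
    (ha : |a| ≤ L * p) (hb : |b| ≤ L * q) :
    |p * (a / p - b / q) ^ 2| ≤ p * (4 * L ^ 2) := by
  have hap : |a / p| ≤ L := by rwa [abs_div, abs_of_pos hp, div_le_iff₀ hp]
  have hbq : |b / q| ≤ L := by rwa [abs_div, abs_of_pos hq, div_le_iff₀ hq]
  rw [abs_of_nonneg (by positivity)]
  refine mul_le_mul_of_nonneg_left ?_ hp.le
  rw [abs_le] at hap hbq
  nlinarith

/-- De Bruijn-type identity for relative entropy under Gaussian smoothing: for compactly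
supported probability measures μ, ν on ℝ and any `t > 0`, the relative entropy
`t ↦ ∫ p_t log (p_t / q_t)` of the smoothed densities is differentiable at `t`, with
derivative equal to minus one half of the Fisher divergence
`∫ p_t (p_t'/p_t − q_t'/q_t)²` (derivatives in the space variable). -/
theorem deBruijn_relativeEntropy (μ ν : Measure ℝ)
    [IsProbabilityMeasure μ] [IsProbabilityMeasure ν]
    (hμ : ∃ K : Set ℝ, IsCompact K ∧ μ Kᶜ = 0)
    (hν : ∃ K : Set ℝ, IsCompact K ∧ ν Kᶜ = 0)
    (t : ℝ) (ht : 0 < t) :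
    HasDerivAt (fun s => ∫ y, heatDensity μ s y * Real.log (heatDensity μ s y / heatDensity ν s y))
      (-(1 / 2) * ∫ y, heatDensity μ t y *
        (deriv (heatDensity μ t) y / heatDensity μ t y
          - deriv (heatDensity ν t) y / heatDensity ν t y) ^ 2) t := by
  obtain ⟨R, hμR, hνR⟩ : ∃ R : ℝ, (∀ᵐ x ∂μ, |x| ≤ R) ∧ ∀ᵐ x ∂ν, |x| ≤ R := by
    obtain ⟨K, hK, hK0⟩ := hμ
    obtain ⟨K', hK', hK'0⟩ := hν
    obtain ⟨R, hR⟩ := (hK.union hK').isBounded.exists_norm_le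
    refine ⟨R, ?_, ?_⟩
    · filter_upwards [mem_ae_iff.mpr hK0] with x hx using hR x (Or.inl hx)
    · filter_upwards [mem_ae_iff.mpr hK'0] with x hx using hR x (Or.inr hx)
  have hIcc : Icc (t / 2) (2 * t) ∈ 𝓝 t := Icc_mem_nhds (by linarith) (by linarith)
  have htI : t ∈ Icc (t / 2) (2 * t) := mem_of_mem_nhds hIcc
  have hpos : ∀ s ∈ Icc (t / 2) (2 * t), 0 < s := fun s hs =>
    lt_of_lt_of_le (by positivity) hs.1
  obtain ⟨c, hc, hsc⟩ : ∃ c : ℝ, 1 ≤ c ∧ ∀ s ∈ Icc (t / 2) (2 * t), 1 / s ≤ c := by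
    refine ⟨1 + 1 / (t / 2), by simp; positivity, fun s hs => ?_⟩
    have : 1 / s ≤ 1 / (t / 2) := one_div_le_one_div_of_le (by positivity) hs.1
    linarith
  set C : ℝ := (Real.sqrt (2 * Real.pi * (t / 2)))⁻¹ * Real.exp (R ^ 2 / (2 * (t / 2))) with hC
  set bound : ℝ → ℝ := fun y =>
    (4 * C) * (heatWeight c R y ^ 2 * Real.exp (-(1 / (4 * (2 * t))) * y ^ 2)) with hbound
  have hbi : Integrable bound :=
    (integrable_heatWeight_sq_mul_exp c R (by positivity)).const_mul _
  have hle : ∀ s ∈ Icc (t / 2) (2 * t), ∀ y x : ℝ,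
      |x| ≤ heatDensity μ s y * (4 * heatWeight c R y ^ 2) → ‖x‖ ≤ bound y := by
    intro s hs y x hx
    refine hx.trans ((mul_le_mul_of_nonneg_right
      (heatDensity_le_exp hμR (by positivity) hs y) (by positivity)).trans_eq ?_)
    simp only [hbound, hC]
    ring
  have hL : ∀ y, 1 ≤ heatWeight c R y := one_le_heatWeight hc R
  have hp : ∀ s ∈ Icc (t / 2) (2 * t), ∀ y, 0 < heatDensity μ s y := fun s hs =>
    heatDensity_pos hμR (hpos s hs)
  have hq : ∀ s ∈ Icc (t / 2) (2 * t), ∀ y, 0 < heatDensity ν s y := fun s hs =>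
    heatDensity_pos hνR (hpos s hs)
  have hl : ∀ s ∈ Icc (t / 2) (2 * t), ∀ y,
      |Real.log (heatDensity μ s y / heatDensity ν s y)| ≤ heatWeight c R y := fun s hs =>
    abs_log_heatDensity_div_le hμR hνR (hpos s hs) hc (hsc s hs)
  have hmeas : ∀ s ∈ Icc (t / 2) (2 * t),
      Measurable (heatDensity μ s) ∧ Measurable (heatDensity ν s) := fun s hs =>
    ⟨(continuous_iff_continuousAt.mpr fun y =>
      (hasDerivAt_heatDensity_space hμR (hpos s hs) y).continuousAt).measurable,
    (continuous_iff_continuousAt.mpr fun y =>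
      (hasDerivAt_heatDensity_space hνR (hpos s hs) y).continuousAt).measurable⟩
  obtain ⟨hmp, hmq⟩ := hmeas t htI
  have hmp1 : Measurable (heatDensityDeriv μ t) :=
    (continuous_iff_continuousAt.mpr fun y =>
      (hasDerivAt_heatDensityDeriv hμR ht y).continuousAt).measurable
  have hmq1 : Measurable (heatDensityDeriv ν t) :=
    (continuous_iff_continuousAt.mpr fun y =>
      (hasDerivAt_heatDensityDeriv hνR ht y).continuousAt).measurable
  have hmp2 : Measurable (heatDensityDeriv₂ μ t) := by
    rw [show heatDensityDeriv₂ μ t = deriv (heatDensityDeriv μ t) from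
      funext fun y => (hasDerivAt_heatDensityDeriv hμR ht y).deriv.symm]
    exact measurable_deriv _
  have hmq2 : Measurable (heatDensityDeriv₂ ν t) := by
    rw [show heatDensityDeriv₂ ν t = deriv (heatDensityDeriv ν t) from
      funext fun y => (hasDerivAt_heatDensityDeriv hνR ht y).deriv.symm]
    exact measurable_deriv _
  set g : ℝ → ℝ → ℝ := fun s y =>
    heatDensityDeriv₂ μ s y * Real.log (heatDensity μ s y / heatDensity ν s y)
      + heatDensityDeriv₂ μ s y
      - heatDensity μ s y * (heatDensityDeriv₂ ν s y / heatDensity ν s y) with hg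
  have hgle : ∀ s ∈ Icc (t / 2) (2 * t), ∀ y, ‖g s y‖ ≤ bound y := fun s hs y =>
    hle s hs y _ (abs_entropy_term_le (hp s hs y) (hq s hs y) (hL y)
      (abs_heatDensityDeriv₂_le hμR (hpos s hs) hc (hsc s hs) y)
      (abs_heatDensityDeriv₂_le hνR (hpos s hs) hc (hsc s hs) y) (hl s hs y))
  have hgm : Measurable (g t) := by
    simp only [hg]
    fun_prop
  have hgi : Integrable (g t) := hbi.mono' hgm.aestronglyMeasurable
    (Eventually.of_forall (hgle t htI))
  have hFm : ∀ s ∈ Icc (t / 2) (2 * t), Measurable fun y =>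
      heatDensity μ s y * Real.log (heatDensity μ s y / heatDensity ν s y) := fun s hs => by
    obtain ⟨h1, h2⟩ := hmeas s hs
    fun_prop
  have htime : HasDerivAt
      (fun s => ∫ y, heatDensity μ s y * Real.log (heatDensity μ s y / heatDensity ν s y))
      (∫ y, 1 / 2 * g t y) t := by
    refine (hasDerivAt_integral_of_dominated_loc_of_deriv_le (bound := bound)
      (F' := fun s y => 1 / 2 * g s y) hIcc ?_ ?_
      (hgm.const_mul _).aestronglyMeasurable ?_ hbi ?_).2
    · filter_upwards [hIcc] with s hs using (hFm s hs).aestronglyMeasurable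
    · refine hbi.mono' (hFm t htI).aestronglyMeasurable (Eventually.of_forall fun y => ?_)
      refine hle t htI y _ ?_
      rw [abs_mul, abs_of_pos (hp t htI y)]
      have := hp t htI y
      gcongr
      nlinarith [hl t htI y, hL y]
    · refine Eventually.of_forall fun y s hs => ?_
      rw [norm_mul]
      refine (mul_le_of_le_one_left (norm_nonneg _) (by norm_num)).trans (hgle s hs y)
    · refine Eventually.of_forall fun y s hs => ?_
      have hpne := (hp s hs y).ne'
      have hqne := (hq s hs y).ne'
      have h1 := hasDerivAt_heatDensity_time hμR (hpos s hs) y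
      have h2 := hasDerivAt_heatDensity_time hνR (hpos s hs) y
      refine (h1.mul ((h1.div h2 hqne).log (div_ne_zero hpne hqne))).congr_deriv ?_
      simp only [hg, Pi.div_apply]
      field_simp
      ring
  have hdμ : deriv (heatDensity μ t) = heatDensityDeriv μ t :=
    funext fun y => (hasDerivAt_heatDensity_space hμR ht y).deriv
  have hdν : deriv (heatDensity ν t) = heatDensityDeriv ν t :=
    funext fun y => (hasDerivAt_heatDensity_space hνR ht y).deriv
  rw [hdμ, hdν]
  set f : ℝ → ℝ := fun y => heatDensity μ t y *
    (heatDensityDeriv μ t y / heatDensity μ t y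
      - heatDensityDeriv ν t y / heatDensity ν t y) ^ 2 with hf
  have hfi : Integrable f := by
    refine hbi.mono' (by rw [hf]; fun_prop) (Eventually.of_forall fun y => hle t htI y _ ?_)
    exact abs_fisher_term_le (hp t htI y) (hq t htI y)
      (abs_heatDensityDeriv_le hμR ht hc (hsc t htI) y)
      (abs_heatDensityDeriv_le hνR ht hc (hsc t htI) y)
  have hparts : ∫ y, (g t y + f y) = 0 := by
    refine integral_eq_zero_of_hasDerivAt_of_integrable (f := fun y =>
      heatDensityDeriv μ t y * Real.log (heatDensity μ t y / heatDensity ν t y)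
        + heatDensityDeriv μ t y
        - heatDensity μ t y * (heatDensityDeriv ν t y / heatDensity ν t y))
      (fun y => ?_) (hgi.add hfi) ?_
    · have hpne := (hp t htI y).ne'
      have hqne := (hq t htI y).ne'
      have p1 := hasDerivAt_heatDensity_space hμR ht y
      have q1 := hasDerivAt_heatDensity_space hνR ht y
      have p2 := hasDerivAt_heatDensityDeriv hμR ht y
      have q2 := hasDerivAt_heatDensityDeriv hνR ht y
      refine (((p2.mul ((p1.div q1 hqne).log (div_ne_zero hpne hqne))).add p2).sub
        (p1.mul (q2.div q1 hqne))).congr_deriv ?_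
      simp only [hg, hf, Pi.div_apply]
      field_simp
      ring
    · refine hbi.mono' (by fun_prop) (Eventually.of_forall fun y => hle t htI y _ ?_)
      exact abs_entropy_term_le (hp t htI y) (hq t htI y) (hL y)
        (abs_heatDensityDeriv_le hμR ht hc (hsc t htI) y)
        (abs_heatDensityDeriv_le hνR ht hc (hsc t htI) y) (hl t htI y)
  rw [integral_add hgi hfi] at hparts
  refine htime.congr_deriv ?_
  rw [integral_const_mul]
  linarith
end
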